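/- Let G be a Garside group of finite type and x ∈ G. There is a unique positive element ρ(x) (possibly trivial) satisfying: (1) x^{ρ(x)} ∈ SSS(x); (2) ρ(x) ⪯ α for every positive α ∈ G satisfying x^α ∈ SSS(x). -/

import Mathlib

/-- A Garside structure of finite type on a group `G`: a submonoid `P` of positive
elements with `P ∩ P⁻¹ = {1}`, such that the prefix order `a ⪯ b ↔ a⁻¹ * b ∈ P` is a
lattice order (with meet `wedge` and join `vee`), together with a Garside element `Δ ∈ P`
whose set of prefixes (the simple elements) is finite and generates `G`, satisfying
`Δ⁻¹ P Δ = P`, and such that every nontrivial positive element has a finite norm. -/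
structure GarsideStructure (G : Type*) [Group G] where
  P : Set G
  one_mem : (1 : G) ∈ P
  mul_mem : ∀ {a b : G}, a ∈ P → b ∈ P → a * b ∈ P
  eq_one_of_mem_of_inv_mem : ∀ a : G, a ∈ P → a⁻¹ ∈ P → a = 1
  wedge : G → G → G
  vee : G → G → G
  wedge_le_left : ∀ a b : G, (wedge a b)⁻¹ * a ∈ P
  wedge_le_right : ∀ a b : G, (wedge a b)⁻¹ * b ∈ P
  le_wedge : ∀ a b c : G, c⁻¹ * a ∈ P → c⁻¹ * b ∈ P → c⁻¹ * wedge a b ∈ P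
  le_vee_left : ∀ a b : G, a⁻¹ * vee a b ∈ P
  le_vee_right : ∀ a b : G, b⁻¹ * vee a b ∈ P
  vee_le : ∀ a b c : G, a⁻¹ * c ∈ P → b⁻¹ * c ∈ P → (vee a b)⁻¹ * c ∈ P
  Δ : G
  Δ_mem : Δ ∈ P
  simples_finite : {s : G | s ∈ P ∧ s⁻¹ * Δ ∈ P}.Finite
  simples_generate : Subgroup.closure {s : G | s ∈ P ∧ s⁻¹ * Δ ∈ P} = (⊤ : Subgroup G)
  conj_Delta_mem : ∀ a : G, a ∈ P → Δ⁻¹ * a * Δ ∈ P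
  mem_of_conj_Delta_mem : ∀ a : G, Δ⁻¹ * a * Δ ∈ P → a ∈ P
  norm_bounded : ∀ x : G, x ∈ P → x ≠ 1 →
    ∃ n : ℕ, ∀ L : List G, (∀ a ∈ L, a ∈ P ∧ a ≠ 1) → L.prod = x → L.length ≤ n

namespace GarsideStructure

variable {G : Type*} [Group G] (gs : GarsideStructure G)

/-- The prefix order: `a ⪯ b`. -/
def pre (a b : G) : Prop := a⁻¹ * b ∈ gs.P

/-- The suffix order: `a ≽ b` (i.e. `b` is a suffix of `a`). -/
def rdvd (a b : G) : Prop := a * b⁻¹ ∈ gs.P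

/-- Greatest common divisor with respect to the suffix order `≽` : `a ∧↰ b`. -/
def rwedge (a b : G) : G := (gs.vee a⁻¹ b⁻¹)⁻¹

/-- Least common multiple with respect to the suffix order `≽` : `a ∨↰ b`. -/
def rvee (a b : G) : G := (gs.wedge a⁻¹ b⁻¹)⁻¹

/-- Simple elements: positive prefixes of `Δ`. -/
def simple (s : G) : Prop := s ∈ gs.P ∧ s⁻¹ * gs.Δ ∈ gs.P

/-- Atoms: nontrivial positive elements which cannot be decomposed in `P`. -/
def atom (a : G) : Prop := a ∈ gs.P ∧ a ≠ 1 ∧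
  ∀ b c : G, b ∈ gs.P → c ∈ gs.P → a = b * c → b = 1 ∨ c = 1

/-- `inf x` : the maximal integer `p` with `Δ^p ⪯ x`. -/
noncomputable def ginf (x : G) : ℤ := sSup {p : ℤ | gs.pre (gs.Δ ^ p) x}

/-- `sup x` : the minimal integer `p` with `x ⪯ Δ^p`. -/
noncomputable def gsup (x : G) : ℤ := sInf {p : ℤ | gs.pre x (gs.Δ ^ p)}

/-- Canonical length `ℓ(x) = sup(x) - inf(x)`. -/
noncomputable def glen (x : G) : ℤ := gs.gsup x - gs.ginf x

/-- `‖x‖` : the maximal number of factors in a decomposition of `x` as a product of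
nontrivial positive elements. -/
noncomputable def gnorm (x : G) : ℕ :=
  sSup {k : ℕ | ∃ L : List G, (∀ a ∈ L, a ∈ gs.P ∧ a ≠ 1) ∧ L.prod = x ∧ L.length = k}

/-- The summit infimum `inf_s(x)` : the maximum of `inf` over the conjugacy class of `x`. -/
noncomputable def ginfs (x : G) : ℤ :=
  sSup {p : ℤ | ∃ y : G, (∃ α : G, α⁻¹ * x * α = y) ∧ p = gs.ginf y}

/-- The summit supremum `sup_s(x)` : the minimum of `sup` over the conjugacy class of `x`. -/
noncomputable def gsups (x : G) : ℤ :=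
  sInf {p : ℤ | ∃ y : G, (∃ α : G, α⁻¹ * x * α = y) ∧ p = gs.gsup y}

/-- The preferred prefix `𝔭(x) = (xΔ^{-inf x}) ∧ (x⁻¹Δ^{sup x}) ∧ Δ`. -/
noncomputable def pp (x : G) : G :=
  gs.wedge (gs.wedge (x * gs.Δ ^ (-gs.ginf x)) (x⁻¹ * gs.Δ ^ gs.gsup x)) gs.Δ

/-- Cyclic (left) sliding `𝔰(x) = 𝔭(x)⁻¹ x 𝔭(x)`. -/
noncomputable def sl (x : G) : G := (gs.pp x)⁻¹ * x * gs.pp x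

/-- The preferred suffix `𝔭↰(x) = (Δ^{-inf x}x) ∧↰ (Δ^{sup x}x⁻¹) ∧↰ Δ`. -/
noncomputable def ps (x : G) : G :=
  gs.rwedge (gs.rwedge (gs.Δ ^ (-gs.ginf x) * x) (gs.Δ ^ gs.gsup x * x⁻¹)) gs.Δ

/-- Cyclic right sliding `𝔰↰(x) = 𝔭↰(x) x 𝔭↰(x)⁻¹`. -/
noncomputable def rsl (x : G) : G := gs.ps x * x * (gs.ps x)⁻¹

/-- The super summit set `SSS(x)` : conjugates of `x` with maximal infimum and minimal
supremum among all conjugates of `x`. -/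
def SSS (x : G) : Set G :=
  {y | (∃ α : G, α⁻¹ * x * α = y) ∧
    ∀ z : G, (∃ α : G, α⁻¹ * x * α = z) → gs.ginf z ≤ gs.ginf y ∧ gs.gsup y ≤ gs.gsup z}

/-- The set of sliding circuits `SC(x)` : conjugates `y` of `x` with `𝔰^m(y) = y` for
some `m ≥ 1`. -/
noncomputable def SC (x : G) : Set G :=
  {y | (∃ α : G, α⁻¹ * x * α = y) ∧ ∃ m : ℕ, 1 ≤ m ∧ (gs.sl)^[m] y = y}

/-- The transport `α^{(1)} = 𝔭(x)⁻¹ α 𝔭(x^α)` of `α` at `x`. -/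
noncomputable def transport (x α : G) : G := (gs.pp x)⁻¹ * α * gs.pp (α⁻¹ * x * α)

/-- Iterated transport `α^{(i)}` of `α` at `x`: `α^{(0)} = α` and `α^{(i+1)}` is the
transport of `α^{(i)}` at `𝔰^i(x)`. -/
noncomputable def transportIter (x α : G) : ℕ → G
  | 0 => α
  | i + 1 => gs.transport ((gs.sl)^[i] x) (transportIter x α i)

/-- `c` is the `⪯`-minimal element `c_s(y)` satisfying `s ⪯ c` and `y^c ∈ SC(x)`. -/
def IsMinSCConj (x y s c : G) : Prop :=
  gs.pre s c ∧ (c⁻¹ * y * c) ∈ gs.SC x ∧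
    ∀ d : G, gs.pre s d → (d⁻¹ * y * d) ∈ gs.SC x → gs.pre c d

/-- `s` is an indecomposable conjugator starting at `u`: `u^s ∈ SC(x)`, `s ≠ 1` and there
is no `t` with `1 ≺ t ≺ s` and `u^t ∈ SC(x)`. -/
def IsIndecomposableConjugator (x u s : G) : Prop :=
  (s⁻¹ * u * s) ∈ gs.SC x ∧ s ≠ 1 ∧
    ¬ ∃ t : G, (gs.pre 1 t ∧ t ≠ 1) ∧ (gs.pre t s ∧ t ≠ s) ∧ (t⁻¹ * u * t) ∈ gs.SC x

/-- `u` is the pullback of `s` at `y = 𝔰(z)` : the `⪯`-minimal positive element with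
`z^u ∈ SSS(x)` and `s ⪯ u^{(1)}` (transport at `z`). -/
def IsPullback (x z s u : G) : Prop :=
  u ∈ gs.P ∧ (u⁻¹ * z * u) ∈ gs.SSS x ∧ gs.pre s (gs.transport z u) ∧
    ∀ u' : G, u' ∈ gs.P → (u'⁻¹ * z * u') ∈ gs.SSS x → gs.pre s (gs.transport z u') →
      gs.pre u u'

/-- The pullback `s_{(1)}` of `s` at `y = 𝔰(z)`. -/
noncomputable def pullbackOne (x z s : G) : G :=
  @Classical.epsilon G ⟨1⟩ (fun u => gs.IsPullback x z s u)

/-- The `k`-fold pullback `s_{(k)}` of `s` at `y = 𝔰^k(z)` (an element at `z`):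
`s_{(0)} = s` and `s_{(k+1)}` is the pullback at `𝔰(z)` (relative to `z`) of the `k`-fold
pullback of `s` at `𝔰^k(𝔰(z)) = y`. -/
noncomputable def pullbackIter (x : G) : G → ℕ → G → G
  | _, 0, s => s
  | z, k + 1, s => gs.pullbackOne x z (pullbackIter x (gs.sl z) k s)

end GarsideStructure

namespace GarsideStructure

section Order

variable {G : Type*} [Group G] (gs : GarsideStructure G)

theorem pre_refl (a : G) : gs.pre a a := by
  simpa [pre] using gs.one_mem

variable {gs}

theorem pre_trans {a b c : G} (hab : gs.pre a b) (hbc : gs.pre b c) : gs.pre a c := by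
  have h := gs.mul_mem hab hbc
  rwa [show a⁻¹ * b * (b⁻¹ * c) = a⁻¹ * c by group] at h

theorem pre_antisymm {a b : G} (hab : gs.pre a b) (hba : gs.pre b a) : a = b := by
  have h := gs.eq_one_of_mem_of_inv_mem _ hab (by simpa [pre] using hba)
  exact inv_mul_eq_one.mp h

theorem pre_mul_left_iff (c : G) {a b : G} : gs.pre (c * a) (c * b) ↔ gs.pre a b := by
  simp [pre, mul_assoc]

theorem one_pre_iff {a : G} : gs.pre 1 a ↔ a ∈ gs.P := by
  simp [pre]

theorem pre_mul_right_Δ_iff {a b : G} : gs.pre (a * gs.Δ) (b * gs.Δ) ↔ gs.pre a b := by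
  have h : (a * gs.Δ)⁻¹ * (b * gs.Δ) = gs.Δ⁻¹ * (a⁻¹ * b) * gs.Δ := by group
  rw [pre, pre, h]
  exact ⟨gs.mem_of_conj_Delta_mem _, gs.conj_Delta_mem _⟩

theorem pre_mul_right_Δ_zpow_iff (p : ℤ) {a b : G} :
    gs.pre (a * gs.Δ ^ p) (b * gs.Δ ^ p) ↔ gs.pre a b := by
  induction p with
  | zero => simp
  | succ n ih => rw [zpow_add_one, ← mul_assoc, ← mul_assoc, pre_mul_right_Δ_iff, ih]
  | pred n ih =>
    rw [← pre_mul_right_Δ_iff, mul_assoc, mul_assoc, ← zpow_add_one, sub_add_cancel, ih]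

theorem mul_pre_Δ_zpow {a b : G} {p q : ℤ} (ha : gs.pre a (gs.Δ ^ p))
    (hb : gs.pre b (gs.Δ ^ q)) : gs.pre (a * b) (gs.Δ ^ (p + q)) := by
  rw [zpow_add]
  exact pre_trans ((pre_mul_left_iff a).mpr hb) ((pre_mul_right_Δ_zpow_iff q).mpr ha)

theorem Δ_zpow_pre_mul {a b : G} {p q : ℤ} (ha : gs.pre (gs.Δ ^ p) a)
    (hb : gs.pre (gs.Δ ^ q) b) : gs.pre (gs.Δ ^ (p + q)) (a * b) := by
  rw [zpow_add]
  exact pre_trans ((pre_mul_right_Δ_zpow_iff q).mpr ha) ((pre_mul_left_iff a).mpr hb)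

theorem inv_pre_Δ_zpow {a : G} {p : ℤ} (ha : gs.pre (gs.Δ ^ p) a) :
    gs.pre a⁻¹ (gs.Δ ^ (-p)) := by
  rw [← pre_mul_left_iff a, ← pre_mul_right_Δ_zpow_iff p]
  simpa [mul_assoc] using ha

theorem Δ_zpow_pre_inv {a : G} {p : ℤ} (ha : gs.pre a (gs.Δ ^ p)) :
    gs.pre (gs.Δ ^ (-p)) a⁻¹ := by
  rw [← pre_mul_left_iff a, ← pre_mul_right_Δ_zpow_iff p]
  simpa [mul_assoc] using ha

theorem pow_pre_Δ_zpow {a : G} {p : ℤ} (ha : gs.pre a (gs.Δ ^ p)) (n : ℕ) :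
    gs.pre (a ^ n) (gs.Δ ^ (n * p)) := by
  induction n with
  | zero => simpa using gs.pre_refl 1
  | succ n ih =>
    rw [pow_succ, Nat.cast_succ, add_one_mul]
    exact mul_pre_Δ_zpow ih ha

theorem Δ_zpow_pre_pow {a : G} {p : ℤ} (ha : gs.pre (gs.Δ ^ p) a) (n : ℕ) :
    gs.pre (gs.Δ ^ (n * p)) (a ^ n) := by
  induction n with
  | zero => simpa using gs.pre_refl 1
  | succ n ih =>
    rw [pow_succ, Nat.cast_succ, add_one_mul]
    exact Δ_zpow_pre_mul ih ha

theorem one_pre_Δ_zpow {p : ℤ} (hp : 0 ≤ p) : gs.pre 1 (gs.Δ ^ p) := by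
  lift p to ℕ using hp
  have h : gs.pre (gs.Δ ^ (0 : ℤ)) gs.Δ := by simpa [pre] using gs.Δ_mem
  simpa using Δ_zpow_pre_pow h p

theorem Δ_zpow_pre_Δ_zpow {p q : ℤ} (h : p ≤ q) : gs.pre (gs.Δ ^ p) (gs.Δ ^ q) := by
  rw [← pre_mul_right_Δ_zpow_iff (-p)]
  rw [← zpow_add, ← zpow_add, add_neg_cancel, zpow_zero, ← sub_eq_add_neg]
  exact one_pre_Δ_zpow (gs := gs) (sub_nonneg.mpr h)

variable (gs) in
theorem exists_Δ_zpow_pre_and_pre (a : G) :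
    ∃ p q : ℤ, gs.pre (gs.Δ ^ p) a ∧ gs.pre a (gs.Δ ^ q) := by
  have ha : a ∈ Subgroup.closure {s : G | s ∈ gs.P ∧ s⁻¹ * gs.Δ ∈ gs.P} := by
    rw [gs.simples_generate]; trivial
  induction ha using Subgroup.closure_induction with
  | mem s hs => exact ⟨0, 1, by simpa [pre] using hs.1, by simpa [pre] using hs.2⟩
  | one => exact ⟨0, 0, by simpa using gs.pre_refl 1, by simpa using gs.pre_refl 1⟩
  | mul a b _ _ ha hb =>
    obtain ⟨p, q, hp, hq⟩ := ha
    obtain ⟨p', q', hp', hq'⟩ := hb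
    exact ⟨_, _, Δ_zpow_pre_mul hp hp', mul_pre_Δ_zpow hq hq'⟩
  | inv a _ ha =>
    obtain ⟨p, q, hp, hq⟩ := ha
    exact ⟨_, _, Δ_zpow_pre_inv hq, inv_pre_Δ_zpow hp⟩

variable (gs) in
theorem Δ_ne_one [Nontrivial G] : gs.Δ ≠ 1 := by
  intro h
  have hle : Subgroup.closure {s : G | s ∈ gs.P ∧ s⁻¹ * gs.Δ ∈ gs.P} ≤ ⊥ := by
    rw [Subgroup.closure_le]
    rintro s ⟨hs, hs'⟩
    exact gs.eq_one_of_mem_of_inv_mem s hs (by simpa [h] using hs')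
  rw [gs.simples_generate] at hle
  exact top_ne_bot (le_bot_iff.mp hle)

theorem Δ_zpow_pre_Δ_zpow_iff [Nontrivial G] {p q : ℤ} :
    gs.pre (gs.Δ ^ p) (gs.Δ ^ q) ↔ p ≤ q := by
  refine ⟨fun h => ?_, Δ_zpow_pre_Δ_zpow⟩
  by_contra! hlt
  have hsucc : gs.pre (gs.Δ ^ (q + 1)) (gs.Δ ^ q) := pre_trans (Δ_zpow_pre_Δ_zpow hlt) h
  have heq := pre_antisymm hsucc (Δ_zpow_pre_Δ_zpow (by lia))
  rw [zpow_add_one] at heq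
  exact gs.Δ_ne_one (mul_eq_left.mp heq)

theorem Δ_zpow_pre_iff_le_ginf [Nontrivial G] {p : ℤ} {a : G} :
    gs.pre (gs.Δ ^ p) a ↔ p ≤ gs.ginf a := by
  obtain ⟨p₀, q₀, hp₀, hq₀⟩ := gs.exists_Δ_zpow_pre_and_pre a
  have hbdd : BddAbove {p : ℤ | gs.pre (gs.Δ ^ p) a} :=
    ⟨q₀, fun p hp => Δ_zpow_pre_Δ_zpow_iff.mp (pre_trans hp hq₀)⟩
  refine ⟨fun h => le_csSup hbdd h, fun h => ?_⟩
  exact pre_trans (Δ_zpow_pre_Δ_zpow h) (Int.csSup_mem ⟨p₀, hp₀⟩ hbdd)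

theorem pre_Δ_zpow_iff_gsup_le [Nontrivial G] {q : ℤ} {a : G} :
    gs.pre a (gs.Δ ^ q) ↔ gs.gsup a ≤ q := by
  obtain ⟨p₀, q₀, hp₀, hq₀⟩ := gs.exists_Δ_zpow_pre_and_pre a
  have hbdd : BddBelow {q : ℤ | gs.pre a (gs.Δ ^ q)} :=
    ⟨p₀, fun q hq => Δ_zpow_pre_Δ_zpow_iff.mp (pre_trans hp₀ hq)⟩
  refine ⟨fun h => csInf_le hbdd h, fun h => ?_⟩
  exact pre_trans (Int.csInf_mem ⟨q₀, hq₀⟩ hbdd) (Δ_zpow_pre_Δ_zpow h)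

/-- The infimum of an element never exceeds the supremum of one of its conjugates. -/
theorem le_of_Δ_zpow_pre_conj [Nontrivial G] {x α : G} {p q : ℤ}
    (hp : gs.pre (gs.Δ ^ p) (α⁻¹ * x * α)) (hq : gs.pre x (gs.Δ ^ q)) : p ≤ q := by
  obtain ⟨-, c, -, hc⟩ := gs.exists_Δ_zpow_pre_and_pre α⁻¹
  obtain ⟨-, d, -, hd⟩ := gs.exists_Δ_zpow_pre_and_pre α
  have key (n : ℕ) : n * p ≤ c + n * q + d := by
    have hpow : (α⁻¹ * x * α) ^ n = α⁻¹ * x ^ n * α := by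
      simpa using conj_pow (i := n) (a := α⁻¹) (b := x)
    have h := Δ_zpow_pre_pow hp n
    rw [hpow] at h
    exact Δ_zpow_pre_Δ_zpow_iff.mp
      (pre_trans h (mul_pre_Δ_zpow (mul_pre_Δ_zpow hc (pow_pre_Δ_zpow hq n)) hd))
  by_contra! hlt
  have h := key ((c + d).natAbs + 1)
  have habs : c + d ≤ (c + d).natAbs := Int.le_natAbs
  push_cast at h habs
  nlinarith [abs_nonneg (c + d)]

/-- A nonempty set of positive elements closed under `∧` has a least element. -/
theorem exists_least_of_wedge_closed {S : Set G} (hne : S.Nonempty)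
    (hpos : ∀ a ∈ S, a ∈ gs.P) (hwedge : ∀ a ∈ S, ∀ b ∈ S, gs.wedge a b ∈ S) :
    ∃ a ∈ S, ∀ b ∈ S, gs.pre a b := by
  have key (n : ℕ) : ∀ a ∈ S,
      (∀ L : List G, (∀ c ∈ L, c ∈ gs.P ∧ c ≠ 1) → L.prod = a → L.length ≤ n) →
      ∃ a ∈ S, ∀ b ∈ S, gs.pre a b := by
    induction n with
    | zero =>
      intro a ha hL
      have h1 : a = 1 := by
        by_contra h1
        simpa using hL [a] (by simpa using ⟨hpos a ha, h1⟩) (by simp)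
      exact ⟨a, ha, fun b hb => h1 ▸ one_pre_iff.mpr (hpos b hb)⟩
    | succ n ih =>
      intro a ha hL
      by_cases hmin : ∀ b ∈ S, gs.pre a b
      · exact ⟨a, ha, hmin⟩
      push Not at hmin
      obtain ⟨b, hb, hab⟩ := hmin
      refine ih _ (hwedge a ha b hb) fun L hLP hprod => ?_
      have hne1 : (gs.wedge a b)⁻¹ * a ≠ 1 := by
        intro h
        apply hab
        have h' := gs.wedge_le_right a b
        rwa [inv_mul_eq_one.mp h] at h'
      have h := hL (L ++ [(gs.wedge a b)⁻¹ * a]) (by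
        intro c hc
        rcases List.mem_append.mp hc with hc | hc
        · exact hLP c hc
        · rw [List.mem_singleton.mp hc]
          exact ⟨gs.wedge_le_left a b, hne1⟩) (by simp [hprod])
      simpa using h
  obtain ⟨a, ha⟩ := hne
  by_cases h1 : a = 1
  · exact ⟨a, ha, fun b hb => h1 ▸ one_pre_iff.mpr (hpos b hb)⟩
  · obtain ⟨n, hn⟩ := gs.norm_bounded a (hpos a ha) h1
    exact key n a ha hn

/-- A nonempty set with a lower bound which is closed under `∧` has a least element. -/
theorem exists_least_of_wedge_closed_of_lower_bound {S : Set G} {β : G} (hne : S.Nonempty)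
    (hβ : ∀ a ∈ S, gs.pre β a) (hwedge : ∀ a ∈ S, ∀ b ∈ S, gs.wedge a b ∈ S) :
    ∃ a ∈ S, ∀ b ∈ S, gs.pre a b := by
  have hmul (a b : G) : β * gs.wedge a b = gs.wedge (β * a) (β * b) := by
    apply pre_antisymm
    · exact gs.le_wedge _ _ _ ((pre_mul_left_iff β).mpr (gs.wedge_le_left a b))
        ((pre_mul_left_iff β).mpr (gs.wedge_le_right a b))
    · rw [← pre_mul_left_iff β⁻¹, inv_mul_cancel_left]
      refine gs.le_wedge _ _ _ ?_ ?_
      · simpa [mul_assoc] using gs.wedge_le_left (β * a) (β * b)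
      · simpa [mul_assoc] using gs.wedge_le_right (β * a) (β * b)
  obtain ⟨a₀, ha₀⟩ := hne
  obtain ⟨a, ha, hleast⟩ := exists_least_of_wedge_closed (gs := gs) (S := {a | β * a ∈ S})
    ⟨β⁻¹ * a₀, by simpa using ha₀⟩
    (fun a ha => by simpa [pre] using hβ _ ha)
    (fun a ha b hb => by
      have h := hwedge _ ha _ hb
      rwa [← hmul] at h)
  refine ⟨β * a, ha, fun b hb => ?_⟩
  rw [← pre_mul_left_iff β⁻¹, inv_mul_cancel_left]
  exact hleast _ (by simpa using hb)

theorem Δ_zpow_pre_conj_iff {x α : G} {p : ℤ} :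
    gs.pre (gs.Δ ^ p) (α⁻¹ * x * α) ↔ gs.pre (x⁻¹ * α * gs.Δ ^ p) α := by
  rw [← pre_mul_left_iff (x⁻¹ * α)]
  simp [mul_assoc]

theorem conj_pre_Δ_zpow_iff {x α : G} {q : ℤ} :
    gs.pre (α⁻¹ * x * α) (gs.Δ ^ q) ↔ gs.pre α (x⁻¹ * α * gs.Δ ^ q) := by
  rw [← pre_mul_left_iff (x⁻¹ * α)]
  simp [mul_assoc]

theorem pre_conj_mul_Δ_zpow {x a b : G} (q : ℤ) (h : gs.pre a b) :
    gs.pre (x⁻¹ * a * gs.Δ ^ q) (x⁻¹ * b * gs.Δ ^ q) := by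
  rwa [pre_mul_right_Δ_zpow_iff, pre_mul_left_iff]

theorem Δ_zpow_pre_conj_wedge {x α β : G} {p : ℤ} (hα : gs.pre (gs.Δ ^ p) (α⁻¹ * x * α))
    (hβ : gs.pre (gs.Δ ^ p) (β⁻¹ * x * β)) :
    gs.pre (gs.Δ ^ p) ((gs.wedge α β)⁻¹ * x * gs.wedge α β) := by
  rw [Δ_zpow_pre_conj_iff] at *
  exact gs.le_wedge _ _ _ (pre_trans (pre_conj_mul_Δ_zpow p (gs.wedge_le_left α β)) hα)
    (pre_trans (pre_conj_mul_Δ_zpow p (gs.wedge_le_right α β)) hβ)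

theorem conj_wedge_pre_Δ_zpow {x α β : G} {q : ℤ} (hα : gs.pre (α⁻¹ * x * α) (gs.Δ ^ q))
    (hβ : gs.pre (β⁻¹ * x * β) (gs.Δ ^ q)) :
    gs.pre ((gs.wedge α β)⁻¹ * x * gs.wedge α β) (gs.Δ ^ q) := by
  rw [conj_pre_Δ_zpow_iff] at *
  have hshift (γ : G) (hγ : gs.pre γ (x⁻¹ * γ * gs.Δ ^ q))
      (h : gs.pre (gs.wedge α β) γ) : gs.pre (x * gs.wedge α β * gs.Δ ^ (-q)) γ := by
    rw [← pre_mul_right_Δ_zpow_iff q, ← pre_mul_left_iff x⁻¹]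
    simpa [mul_assoc] using pre_trans h hγ
  have h : gs.pre (x * gs.wedge α β * gs.Δ ^ (-q)) (gs.wedge α β) :=
    gs.le_wedge _ _ _ (hshift α hα (gs.wedge_le_left α β))
      (hshift β hβ (gs.wedge_le_right α β))
  rw [← pre_mul_right_Δ_zpow_iff q, ← pre_mul_left_iff x⁻¹] at h
  simpa [mul_assoc] using h

theorem Δ_zpow_pre_conj_mul_Δ_zpow {x α : G} {p : ℤ} (k : ℤ)
    (h : gs.pre (gs.Δ ^ p) (α⁻¹ * x * α)) :
    gs.pre (gs.Δ ^ p) ((α * gs.Δ ^ k)⁻¹ * x * (α * gs.Δ ^ k)) := by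
  rw [Δ_zpow_pre_conj_iff] at *
  rw [← pre_mul_right_Δ_zpow_iff k] at h
  have hcomm : x⁻¹ * (α * gs.Δ ^ k) * gs.Δ ^ p = x⁻¹ * α * gs.Δ ^ p * gs.Δ ^ k := by
    simp only [mul_assoc, ← zpow_add, add_comm]
  rwa [hcomm]

theorem conj_mul_Δ_zpow_pre_Δ_zpow {x α : G} {q : ℤ} (k : ℤ)
    (h : gs.pre (α⁻¹ * x * α) (gs.Δ ^ q)) :
    gs.pre ((α * gs.Δ ^ k)⁻¹ * x * (α * gs.Δ ^ k)) (gs.Δ ^ q) := by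
  rw [conj_pre_Δ_zpow_iff] at *
  rw [← pre_mul_right_Δ_zpow_iff k] at h
  have hcomm : x⁻¹ * (α * gs.Δ ^ k) * gs.Δ ^ q = x⁻¹ * α * gs.Δ ^ q * gs.Δ ^ k := by
    simp only [mul_assoc, ← zpow_add, add_comm]
  rwa [hcomm]

variable (gs) in
theorem exists_pre_mul_Δ_zpow (a b : G) : ∃ k : ℤ, gs.pre b (a * gs.Δ ^ k) := by
  obtain ⟨-, k, -, hk⟩ := gs.exists_Δ_zpow_pre_and_pre (a⁻¹ * b)
  refine ⟨k, ?_⟩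
  rw [← pre_mul_left_iff a⁻¹]
  simpa using hk

/-- A lower bound on the infimum and an upper bound on the supremum that are each reached in
a conjugacy class are reached simultaneously. -/
theorem exists_conj_between {x α β : G} {p q : ℤ} (hα : gs.pre (gs.Δ ^ p) (α⁻¹ * x * α))
    (hβ : gs.pre (β⁻¹ * x * β) (gs.Δ ^ q)) :
    ∃ γ : G, gs.pre (gs.Δ ^ p) (γ⁻¹ * x * γ) ∧ gs.pre (γ⁻¹ * x * γ) (gs.Δ ^ q) := by
  obtain ⟨k, hk⟩ := gs.exists_pre_mul_Δ_zpow α β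
  obtain ⟨γ, ⟨hγ, hβγ⟩, hleast⟩ := exists_least_of_wedge_closed_of_lower_bound (gs := gs)
    (S := {γ | gs.pre (gs.Δ ^ p) (γ⁻¹ * x * γ) ∧ gs.pre β γ})
    ⟨_, Δ_zpow_pre_conj_mul_Δ_zpow k hα, hk⟩ (fun _ h => h.2)
    (fun a ha b hb => ⟨Δ_zpow_pre_conj_wedge ha.1 hb.1, gs.le_wedge _ _ _ ha.2 hb.2⟩)
  refine ⟨γ, hγ, conj_pre_Δ_zpow_iff.mpr (hleast _ ⟨?_, ?_⟩)⟩
  · have h : gs.pre (gs.Δ ^ p) ((x⁻¹ * γ)⁻¹ * x * (x⁻¹ * γ)) := by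
      simpa [mul_assoc] using hγ
    exact Δ_zpow_pre_conj_mul_Δ_zpow q h
  · exact pre_trans (conj_pre_Δ_zpow_iff.mp hβ) (pre_conj_mul_Δ_zpow q hβγ)

/-- The super summit set is nonempty, and is cut out of the conjugacy class by one lower bound
on the infimum and one upper bound on the supremum. -/
theorem exists_conj_mem_SSS_iff [Nontrivial G] (gs : GarsideStructure G) (x : G) :
    ∃ p q : ℤ, (∃ α : G, α⁻¹ * x * α ∈ gs.SSS x) ∧ ∀ α : G, α⁻¹ * x * α ∈ gs.SSS x ↔
      gs.pre (gs.Δ ^ p) (α⁻¹ * x * α) ∧ gs.pre (α⁻¹ * x * α) (gs.Δ ^ q) := by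
  obtain ⟨p, ⟨α, hα⟩, hp⟩ := Int.exists_greatest_of_bdd
    (P := fun p => ∃ α : G, gs.pre (gs.Δ ^ p) (α⁻¹ * x * α))
    ⟨gs.gsup x, fun p ⟨α, hα⟩ => le_of_Δ_zpow_pre_conj hα (pre_Δ_zpow_iff_gsup_le.mpr le_rfl)⟩
    ⟨gs.ginf x, 1, by simpa using Δ_zpow_pre_iff_le_ginf.mpr le_rfl⟩
  obtain ⟨q, ⟨β, hβ⟩, hq⟩ := Int.exists_least_of_bdd
    (P := fun q => ∃ β : G, gs.pre (β⁻¹ * x * β) (gs.Δ ^ q))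
    ⟨gs.ginf x, fun q ⟨β, hβ⟩ => le_of_Δ_zpow_pre_conj (α := β⁻¹)
      (by simpa [mul_assoc] using Δ_zpow_pre_iff_le_ginf.mpr (le_refl (gs.ginf x))) hβ⟩
    ⟨gs.gsup x, 1, by simpa using pre_Δ_zpow_iff_gsup_le.mpr le_rfl⟩
  obtain ⟨γ, hγp, hγq⟩ := exists_conj_between hα hβ
  have hiff (δ : G) : δ⁻¹ * x * δ ∈ gs.SSS x ↔
      gs.pre (gs.Δ ^ p) (δ⁻¹ * x * δ) ∧ gs.pre (δ⁻¹ * x * δ) (gs.Δ ^ q) := by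
    rw [Δ_zpow_pre_iff_le_ginf, pre_Δ_zpow_iff_gsup_le]
    rw [Δ_zpow_pre_iff_le_ginf] at hγp
    rw [pre_Δ_zpow_iff_gsup_le] at hγq
    constructor
    · rintro ⟨-, h⟩
      obtain ⟨h₁, h₂⟩ := h _ ⟨γ, rfl⟩
      exact ⟨hγp.trans h₁, h₂.trans hγq⟩
    · rintro ⟨h₁, h₂⟩
      refine ⟨⟨δ, rfl⟩, ?_⟩
      rintro z ⟨ε, rfl⟩
      exact ⟨(hp _ ⟨ε, Δ_zpow_pre_iff_le_ginf.mpr le_rfl⟩).trans h₁,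
        h₂.trans (hq _ ⟨ε, pre_Δ_zpow_iff_gsup_le.mpr le_rfl⟩)⟩
  exact ⟨p, q, ⟨γ, (hiff γ).mpr ⟨hγp, hγq⟩⟩, hiff⟩

end Order

end GarsideStructure

open GarsideStructure

variable {G : Type*} [Group G]

/-- There is a unique `⪯`-minimal positive element conjugating `x` into `SSS(x)`. -/
theorem sss_minimal (gs : GarsideStructure G) (x : G) :
    ∃! ρ : G, ρ ∈ gs.P ∧ ρ⁻¹ * x * ρ ∈ gs.SSS x ∧
      ∀ α : G, α ∈ gs.P → α⁻¹ * x * α ∈ gs.SSS x → gs.pre ρ α := by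
  rcases subsingleton_or_nontrivial G with _ | _
  · refine ⟨1, ⟨gs.one_mem, ⟨⟨1, rfl⟩, fun z _ => ?_⟩, fun α _ _ => ?_⟩,
      fun _ _ => Subsingleton.elim _ _⟩
    · rw [Subsingleton.elim z (1⁻¹ * x * 1)]
      exact ⟨le_rfl, le_rfl⟩
    · rw [Subsingleton.elim α 1]
      exact gs.pre_refl 1
  obtain ⟨p, q, ⟨α, hα⟩, hiff⟩ := gs.exists_conj_mem_SSS_iff x
  simp only [hiff] at hα ⊢
  obtain ⟨k, hk⟩ := gs.exists_pre_mul_Δ_zpow α 1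
  obtain ⟨ρ, ⟨hρ, hρS⟩, hleast⟩ := exists_least_of_wedge_closed (gs := gs)
    (S := {ρ | ρ ∈ gs.P ∧ gs.pre (gs.Δ ^ p) (ρ⁻¹ * x * ρ) ∧ gs.pre (ρ⁻¹ * x * ρ) (gs.Δ ^ q)})
    ⟨_, one_pre_iff.mp hk, Δ_zpow_pre_conj_mul_Δ_zpow k hα.1, conj_mul_Δ_zpow_pre_Δ_zpow k hα.2⟩
    (fun _ h => h.1)
    (fun a ha b hb => ⟨one_pre_iff.mp
      (gs.le_wedge _ _ _ (one_pre_iff.mpr ha.1) (one_pre_iff.mpr hb.1)),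
      Δ_zpow_pre_conj_wedge ha.2.1 hb.2.1, conj_wedge_pre_Δ_zpow ha.2.2 hb.2.2⟩)
  refine ⟨ρ, ⟨hρ, hρS, fun β hβ hβS => hleast β ⟨hβ, hβS⟩⟩, ?_⟩
  rintro σ ⟨hσ, hσS, hσleast⟩
  exact pre_antisymm (hσleast ρ hρ hρS) (hleast σ ⟨hσ, hσS⟩)
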